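/- For every integer n ≥ 2, ∑_{k=3}^{n} (−1)^k · 2cos(2π/k) · exp(2πi(1/k − 2H_k)) = −1 + (−1)^n · exp(−4πi·H_n). -/

import Mathlib

open Real Filter Topology

/-- The `k`-th harmonic number `H_k = ∑_{m=1}^{k} 1/m`. -/
noncomputable def H (k : ℕ) : ℝ := ∑ m ∈ Finset.Icc 1 k, (1 : ℝ) / m

theorem H_succ (k : ℕ) : H (k + 1) = H k + 1 / ((k + 1 : ℕ) : ℝ) := by
  simp [H, Finset.sum_Icc_succ_top]

theorem H_two : H 2 = 3 / 2 := by
  norm_num [H, Finset.sum_Icc_succ_top]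

theorem two_cos_mul_exp (k : ℕ) :
    ((2 * Real.cos (2 * π / ((k + 1 : ℕ) : ℝ)) : ℝ) : ℂ) *
        Complex.exp (2 * (π : ℂ) * Complex.I *
          (1 / ((k + 1 : ℕ) : ℂ) - 2 * (H (k + 1) : ℂ))) =
      Complex.exp (-4 * (π : ℂ) * Complex.I * (H k : ℂ)) +
        Complex.exp (-4 * (π : ℂ) * Complex.I * (H (k + 1) : ℂ)) := by
  rw [H_succ, Complex.ofReal_mul, Complex.ofReal_ofNat, Complex.ofReal_cos, Complex.two_cos,
    add_mul, ← Complex.exp_add, ← Complex.exp_add]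
  push_cast
  congr 2 <;> ring

theorem telescoping_vertex_sum (n : ℕ) (hn : 2 ≤ n) :
    ∑ k ∈ Finset.Icc 3 n,
        (-1 : ℂ) ^ k * ((2 * Real.cos (2 * π / (k : ℝ)) : ℝ) : ℂ) *
          Complex.exp (2 * (π : ℂ) * Complex.I * (1 / (k : ℂ) - 2 * (H k : ℂ))) =
      -1 + (-1 : ℂ) ^ n * Complex.exp (-4 * (π : ℂ) * Complex.I * (H n : ℂ)) := by
  induction n, hn using Nat.le_induction with
  | base =>
    have h : Complex.exp (-4 * (π : ℂ) * Complex.I * (H 2 : ℂ)) = 1 := by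
      rw [Complex.exp_eq_one_iff]
      refine ⟨-3, ?_⟩
      rw [H_two]
      push_cast
      ring
    rw [h]
    simp
  | succ k hk ih =>
    rw [Finset.sum_Icc_succ_top (by lia), ih, mul_assoc ((-1 : ℂ) ^ (k + 1)), two_cos_mul_exp]
    ring
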